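/- Consider a two-player extensive-form game (as in the model below) satisfying perfect recall, and let v ∈ 𝒱. If σ₁ ∈ Σ₁ satisfies v[σ₁, ∅] = 0, then v[σ₁, σ₂] = 0 for every σ₂ ∈ Σ₂ such that (σ₁, σ₂) is relevant. Symmetrically, if σ₂ ∈ Σ₂ satisfies v[∅, σ₂] = 0, then v[σ₁, σ₂] = 0 for every σ₁ ∈ Σ₁ such that (σ₁, σ₂) is relevant. -/

import Mathlib

open scoped Classical

/-- The type of "sequences" of a player: `none` is the empty sequence `∅`, and
`some (I, a)` is the sequence consisting of information set `I` (a set of nodes)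
together with action `a` at `I`. -/
abbrev SeqP := Option (Set (List ℕ) × ℕ)

/-- The type of (candidate) reduced-normal-form plans: partial functions from
information sets to actions, encoded with `Option`. -/
abbrev PlanT := Set (List ℕ) → Option ℕ

/-- Two information sets (of the two players) are connected, `I ⇌ J`, if some node
of one is a prefix of some node of the other. -/
def Connected (I J : Set (List ℕ)) : Prop := ∃ u ∈ I, ∃ v ∈ J, u <+: v ∨ v <+: u

/-- A two-player extensive-form game.  Nodes are histories (finite lists of naturals),
`H` is the finite, prefix-closed set of nodes.  The two players are `0` and `1`
(as elements of `Fin 2`, embedded into `Fin 3` via `Fin.castSucc`), and an internal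
node `u` with `owner u = 2` is a chance node.  `sim i` is the information-partition
equivalence relation of player `i` on the internal nodes owned by player `i`. -/
structure EFG where
  H : Finset (List ℕ)
  root_mem : ([] : List ℕ) ∈ H
  prefix_closed : ∀ u v : List ℕ, u <+: v → v ∈ H → u ∈ H
  owner : List ℕ → Fin 3
  sim : Fin 2 → List ℕ → List ℕ → Prop
  sim_mem : ∀ i u v, sim i u v → (∃ a, u ++ [a] ∈ H) ∧ owner u = Fin.castSucc i
  sim_refl : ∀ i u, (∃ a, u ++ [a] ∈ H) → owner u = Fin.castSucc i → sim i u u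
  sim_symm : ∀ i u v, sim i u v → sim i v u
  sim_trans : ∀ i u v w, sim i u v → sim i v w → sim i u w
  sim_actions : ∀ i u v, sim i u v → ∀ a : ℕ, u ++ [a] ∈ H ↔ v ++ [a] ∈ H

namespace EFG

variable (G : EFG)

/-- A node is internal if it has at least one child in the tree. -/
def Internal (u : List ℕ) : Prop := ∃ a, u ++ [a] ∈ G.H

/-- The (finite) set of actions `A(u) = {a : u ++ [a] ∈ H}` available at node `u`. -/
noncomputable def actions (u : List ℕ) : Finset ℕ :=
  (G.H.finite_toSet.preimage (f := fun a : ℕ => u ++ [a])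
    (fun a _ b _ hab => by simpa using hab)).toFinset

/-- `I` is an information set of player `i`: an equivalence class of `sim i`. -/
def InfoSet (i : Fin 2) (I : Set (List ℕ)) : Prop :=
  ∃ u, G.sim i u u ∧ I = {v | G.sim i u v}

/-- `seqᵢ(u)`: the list (ordered by increasing length of the prefix `w`) of pairs
`(I, a)` such that `w ++ [a] ≼ u` for some internal node `w` owned by player `i`
whose information set is `I`. -/
noncomputable def playerSeq (i : Fin 2) (u : List ℕ) : List (Set (List ℕ) × ℕ) :=
  (List.range u.length).filterMap fun k =>
    if G.Internal (u.take k) ∧ G.owner (u.take k) = Fin.castSucc i then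
      some ({v | G.sim i (u.take k) v}, u.getD k 0)
    else none

/-- Perfect recall: nodes in the same information set have the same player sequence. -/
def PerfectRecall : Prop := ∀ i u v, G.sim i u v → G.playerSeq i u = G.playerSeq i v

/-- The parent sequence `σ(I)` of an information set `I` of player `i`: the last
element of `seqᵢ(u)` for `u ∈ I` (`none` encodes the empty sequence `∅`). -/
noncomputable def parentSeq (i : Fin 2) (I : Set (List ℕ)) : SeqP :=
  if h : ∃ u, u ∈ I then (G.playerSeq i h.choose).getLast? else none

/-- All chance moves are public: any two nodes in the same information set have
the same set of chance moves (pairs of a chance node and an action) on their paths. -/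
def PublicChance : Prop :=
  ∀ i u v, G.sim i u v →
    {p : List ℕ × ℕ | G.Internal p.1 ∧ G.owner p.1 = 2 ∧ p.1 ++ [p.2] <+: u} =
    {p : List ℕ × ℕ | G.Internal p.1 ∧ G.owner p.1 = 2 ∧ p.1 ++ [p.2] <+: v}

/-- Triangle-freeness of the game. -/
def TriangleFree : Prop :=
  ¬ ∃ I₁ I₂ J₁ J₂ : Set (List ℕ),
      G.InfoSet 0 I₁ ∧ G.InfoSet 0 I₂ ∧ G.InfoSet 1 J₁ ∧ G.InfoSet 1 J₂ ∧
      I₁ ≠ I₂ ∧ J₁ ≠ J₂ ∧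
      G.parentSeq 0 I₁ = G.parentSeq 0 I₂ ∧ G.parentSeq 1 J₁ = G.parentSeq 1 J₂ ∧
      Connected I₁ J₁ ∧ Connected I₂ J₂ ∧ Connected I₁ J₂

/-- `σ` is a member of `Σᵢ`, the set of sequences of player `i`. -/
def IsSeq (i : Fin 2) (σ : SeqP) : Prop :=
  σ = none ∨ ∃ I a, σ = some (I, a) ∧ G.InfoSet i I ∧ ∃ u ∈ I, u ++ [a] ∈ G.H

/-- `(σ₁, σ₂)` is a relevant sequence pair, `σ₁ ⇌ σ₂`. -/
def RelPair (σ₁ σ₂ : SeqP) : Prop :=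
  G.IsSeq 0 σ₁ ∧ G.IsSeq 1 σ₂ ∧
    (σ₁ = none ∨ σ₂ = none ∨
      ∃ I₁ a₁ I₂ a₂, σ₁ = some (I₁, a₁) ∧ σ₂ = some (I₂, a₂) ∧ Connected I₁ I₂)

/-- `σ₂ ∈ Σ₂` is relevant for the player-1 information set `I₁`. -/
def RelFor₁ (σ₂ : SeqP) (I₁ : Set (List ℕ)) : Prop :=
  σ₂ = none ∨ ∃ I₂ a₂, σ₂ = some (I₂, a₂) ∧ Connected I₁ I₂

/-- `σ₁ ∈ Σ₁` is relevant for the player-2 information set `I₂`. -/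
def RelFor₂ (σ₁ : SeqP) (I₂ : Set (List ℕ)) : Prop :=
  σ₁ = none ∨ ∃ I₁ a₁, σ₁ = some (I₁, a₁) ∧ Connected I₁ I₂

/-- The index set of correlation plans: the relevant sequence pairs `Σ₁ ⇌ Σ₂`. -/
abbrev Idx := {p : SeqP × SeqP // G.RelPair p.1 p.2}

/-- The entry of a vector `v` indexed by relevant pairs at the pair `(σ₁, σ₂)`
(and `0` at irrelevant pairs, which never occur in the constraints below). -/
noncomputable def val (v : G.Idx → ℝ) (σ₁ σ₂ : SeqP) : ℝ :=
  if h : G.RelPair σ₁ σ₂ then v ⟨(σ₁, σ₂), h⟩ else 0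

/-- The von Stengel–Forges polytope `𝒱`. -/
def VSF : Set (G.Idx → ℝ) :=
  {v | (∀ p, 0 ≤ v p) ∧
    G.val v none none = 1 ∧
    (∀ I₁, G.InfoSet 0 I₁ → ∀ σ₂, G.IsSeq 1 σ₂ → RelFor₁ σ₂ I₁ → ∀ u ∈ I₁,
      ∑ a ∈ G.actions u, G.val v (some (I₁, a)) σ₂ = G.val v (G.parentSeq 0 I₁) σ₂) ∧
    (∀ I₂, G.InfoSet 1 I₂ → ∀ σ₁, G.IsSeq 0 σ₁ → RelFor₂ σ₁ I₂ → ∀ u ∈ I₂,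
      ∑ a ∈ G.actions u, G.val v σ₁ (some (I₂, a)) = G.val v σ₁ (G.parentSeq 1 I₂))}

/-- `π` is a reduced-normal-form plan for player `i`. -/
def IsPlan (i : Fin 2) (π : PlanT) : Prop :=
  (∀ I, ¬ G.InfoSet i I → π I = none) ∧
  (∀ I, G.InfoSet i I →
    ((π I).isSome = true ↔ ∀ u ∈ I, ∀ p ∈ G.playerSeq i u, π p.1 = some p.2)) ∧
  (∀ I a, G.InfoSet i I → π I = some a → ∃ u ∈ I, u ++ [a] ∈ G.H)

/-- `Πᵢ(σ)`: the set of reduced-normal-form plans of player `i` compatible with `σ`. -/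
def PlanSet (i : Fin 2) : SeqP → Set PlanT
  | none => {π | G.IsPlan i π}
  | some (I, a) => {π | G.IsPlan i π ∧ π I = some a}

/-- `μ` is a probability distribution on `Π₁ × Π₂`. -/
def IsDist (μ : PlanT × PlanT → ℝ) : Prop :=
  (∀ q, 0 ≤ μ q) ∧ (Function.support μ).Finite ∧
  (∀ q, μ q ≠ 0 → G.IsPlan 0 q.1 ∧ G.IsPlan 1 q.2) ∧
  ∑ᶠ q, μ q = 1

/-- The linear map `f` from distributions on `Π₁ × Π₂` to correlation plans. -/
noncomputable def corrMap (μ : PlanT × PlanT → ℝ) : G.Idx → ℝ :=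
  fun p => ∑ᶠ q ∈ {q : PlanT × PlanT | q.1 ∈ G.PlanSet 0 p.1.1 ∧ q.2 ∈ G.PlanSet 1 p.1.2}, μ q

/-- The polytope of correlation plans `Ξ`: the image of the probability distributions
on `Π₁ × Π₂` under `f`. -/
def corrPoly : Set (G.Idx → ℝ) := {x | ∃ μ, G.IsDist μ ∧ x = G.corrMap μ}

/-- The `σ₁`-rank of a player-2 information set `I₂`: the number of player-1
information sets connected to `I₂` whose parent sequence is `σ₁`. -/
noncomputable def rank₁ (σ₁ : SeqP) (I₂ : Set (List ℕ)) : ℕ :=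
  Nat.card {J : Set (List ℕ) // G.InfoSet 0 J ∧ Connected J I₂ ∧ G.parentSeq 0 J = σ₁}

/-- The `σ₂`-rank of a player-1 information set `I₁`: the number of player-2
information sets connected to `I₁` whose parent sequence is `σ₂`. -/
noncomputable def rank₂ (σ₂ : SeqP) (I₁ : Set (List ℕ)) : ℕ :=
  Nat.card {J : Set (List ℕ) // G.InfoSet 1 J ∧ Connected I₁ J ∧ G.parentSeq 1 J = σ₂}

end EFG

/-- The point-mass distribution `𝟙_{q₀}` on pairs of plans. -/
noncomputable def pointMass (q₀ : PlanT × PlanT) : PlanT × PlanT → ℝ :=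
  fun q => if q = q₀ then 1 else 0

namespace EFG

theorem mem_actions (G : EFG) (u : List ℕ) (a : ℕ) : a ∈ G.actions u ↔ u ++ [a] ∈ G.H := by
  simp [actions]

theorem val_nonneg (G : EFG) {v : G.Idx → ℝ} (hv : ∀ p, 0 ≤ v p) (σ₁ σ₂ : SeqP) :
    0 ≤ G.val v σ₁ σ₂ := by
  unfold val
  split_ifs
  exacts [hv _, le_rfl]

theorem InfoSet.eq_setOf_sim {G : EFG} {i : Fin 2} {I : Set (List ℕ)} (hI : G.InfoSet i I)
    {u : List ℕ} (hu : u ∈ I) : I = {v | G.sim i u v} := by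
  obtain ⟨w, -, rfl⟩ := hI
  ext x
  exact ⟨fun hx => G.sim_trans i u w x (G.sim_symm i w u hu) hx,
    fun hx => G.sim_trans i w u x hu hx⟩

theorem InfoSet.append_mem {G : EFG} {i : Fin 2} {I : Set (List ℕ)} (hI : G.InfoSet i I)
    {u v : List ℕ} (hu : u ∈ I) (hv : v ∈ I) {a : ℕ} (ha : u ++ [a] ∈ G.H) :
    v ++ [a] ∈ G.H := by
  rw [hI.eq_setOf_sim hu] at hv
  exact (G.sim_actions i u v hv a).1 ha

/-- Under perfect recall the parent sequence can be read off at any node of the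
information set. -/
theorem parentSeq_eq_getLast? (G : EFG) (hpr : G.PerfectRecall) {i : Fin 2}
    {I : Set (List ℕ)} (hI : G.InfoSet i I) {u : List ℕ} (hu : u ∈ I) :
    G.parentSeq i I = (G.playerSeq i u).getLast? := by
  have h : ∃ u, u ∈ I := ⟨u, hu⟩
  have hc : h.choose ∈ {v | G.sim i u v} := hI.eq_setOf_sim hu ▸ h.choose_spec
  rw [parentSeq, dif_pos h, hpr i u _ hc]

theorem exists_prefix_of_mem_playerSeq (G : EFG) {i : Fin 2} {u : List ℕ} (hu : u ∈ G.H)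
    {J : Set (List ℕ)} {b : ℕ} (h : (J, b) ∈ G.playerSeq i u) :
    ∃ w, w ∈ J ∧ G.InfoSet i J ∧ w <+: u ∧ w.length < u.length ∧ w ++ [b] ∈ G.H := by
  rw [playerSeq, List.mem_filterMap] at h
  obtain ⟨k, hk, h⟩ := h
  rw [List.mem_range] at hk
  split_ifs at h with hc
  simp only [Option.some.injEq, Prod.mk.injEq] at h
  obtain ⟨rfl, rfl⟩ := h
  have hs := G.sim_refl i _ hc.1 hc.2
  refine ⟨u.take k, hs, ⟨_, hs, rfl⟩, List.take_prefix k u, by simp [hk], ?_⟩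
  refine G.prefix_closed _ u ?_ hu
  have : u.take k ++ [u.getD k 0] = u.take (k + 1) := by
    rw [List.take_add_one, List.getD_eq_getElem?_getD, List.getElem?_eq_getElem hk]
    rfl
  rw [this]
  exact List.take_prefix _ u

/-- A nonnegative function on the sequences of player `i` that vanishes at the empty sequence
and satisfies the flow constraints at the information sets having a node comparable to `u`
vanishes at all sequences of these information sets. -/
theorem eq_zero_of_flow (G : EFG) (hpr : G.PerfectRecall) {i : Fin 2} {f : SeqP → ℝ}
    (hf : ∀ σ, 0 ≤ f σ) (hf0 : f none = 0) (u : List ℕ)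
    (hflow : ∀ I, G.InfoSet i I → ∀ w ∈ I, (u <+: w ∨ w <+: u) →
      ∑ a ∈ G.actions w, f (some (I, a)) = f (G.parentSeq i I))
    (w : List ℕ) (hw : u <+: w ∨ w <+: u) (I : Set (List ℕ)) (hI : G.InfoSet i I)
    (hwI : w ∈ I) (a : ℕ) (ha : w ++ [a] ∈ G.H) : f (some (I, a)) = 0 := by
  induction hn : w.length using Nat.strong_induction_on generalizing w I a with
  | _ n ih =>
    have hp : f (G.parentSeq i I) = 0 := by
      rw [G.parentSeq_eq_getLast? hpr hI hwI]
      rcases hl : (G.playerSeq i w).getLast? with _ | ⟨J, b⟩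
      · exact hf0
      · obtain ⟨x, hxJ, hJ, hxw, hlt, hxb⟩ := G.exists_prefix_of_mem_playerSeq
          (G.prefix_closed _ _ (List.prefix_append _ _) ha) (List.mem_of_getLast? hl)
        refine ih x.length (hn ▸ hlt) x ?_ J hJ hxJ b hxb rfl
        rcases hw with h | h
        · exact List.prefix_or_prefix_of_prefix h hxw
        · exact Or.inr (hxw.trans h)
    have hsum := (hflow I hI w hwI hw).trans hp
    exact (Finset.sum_eq_zero_iff_of_nonneg fun _ _ => hf _).1 hsum a ((G.mem_actions w a).2 ha)

end EFG

/-- Let `v ∈ 𝒱`.  If `σ₁ ∈ Σ₁` satisfies `v[σ₁, ∅] = 0`, then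
`v[σ₁, σ₂] = 0` for every `σ₂` such that `(σ₁, σ₂)` is relevant; and symmetrically
for `σ₂ ∈ Σ₂` with `v[∅, σ₂] = 0`. -/
theorem VSF_zero_of_zero (G : EFG) (hpr : G.PerfectRecall)
    (v : G.Idx → ℝ) (hv : v ∈ G.VSF) :
    (∀ σ₁ : SeqP, G.IsSeq 0 σ₁ → G.val v σ₁ none = 0 →
      ∀ σ₂ : SeqP, G.RelPair σ₁ σ₂ → G.val v σ₁ σ₂ = 0) ∧
    (∀ σ₂ : SeqP, G.IsSeq 1 σ₂ → G.val v none σ₂ = 0 →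
      ∀ σ₁ : SeqP, G.RelPair σ₁ σ₂ → G.val v σ₁ σ₂ = 0) := by
  obtain ⟨hnn, h1, hv₁, hv₂⟩ := hv
  constructor
  · rintro σ₁ hσ₁ h0 σ₂ ⟨-, hσ₂, hrel⟩
    rcases hrel with rfl | rfl | ⟨I₁, a₁, I₂, a₂, rfl, rfl, u, hu, w, hw, huw⟩
    · exact absurd (h1.symm.trans h0) one_ne_zero
    · exact h0
    · obtain h | ⟨_, _, h, hI, x, hx, hxa⟩ := hσ₂
      · cases h
      · cases h
        refine G.eq_zero_of_flow hpr (f := fun σ => G.val v (some (I₁, a₁)) σ)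
          (fun σ => G.val_nonneg hnn _ σ) h0 u ?_ w huw I₂ hI hw a₂ (hI.append_mem hx hw hxa)
        exact fun J hJ y hy huy =>
          hv₂ J hJ _ hσ₁ (Or.inr ⟨I₁, a₁, rfl, u, hu, y, hy, huy⟩) y hy
  · rintro σ₂ hσ₂ h0 σ₁ ⟨hσ₁, -, hrel⟩
    rcases hrel with rfl | rfl | ⟨I₁, a₁, I₂, a₂, rfl, rfl, w, hw, u, hu, hwu⟩
    · exact h0
    · exact absurd (h1.symm.trans h0) one_ne_zero
    · obtain h | ⟨_, _, h, hI, x, hx, hxa⟩ := hσ₁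
      · cases h
      · cases h
        refine G.eq_zero_of_flow hpr (f := fun σ => G.val v σ (some (I₂, a₂)))
          (fun σ => G.val_nonneg hnn σ _) h0 u ?_ w hwu.symm I₁ hI hw a₁
          (hI.append_mem hx hw hxa)
        exact fun J hJ y hy huy =>
          hv₁ J hJ _ hσ₂ (Or.inr ⟨I₂, a₂, rfl, y, hy, u, hu, huy.symm⟩) y hy
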